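/- arXiv:2401.10856 — 3 statements merged into one kernel-verified Lean document; each statement's English description precedes it below -/
import Mathlib

section
/- Assume every vertex v ≠ r has a minimal mincut, denoted X_v, that these sets X_v (v ≠ r) are pairwise distinct, and set X_r := V. Then for every vertex v ≠ r there exists exactly one vertex p ∈ V such that X_v ⊊ X_p and no vertex u satisfies X_v ⊊ X_u ⊊ X_p. -/
open Finset

variable {V : Type*} [Fintype V] [DecidableEq V]

/-- `cutW w X Y` is `C(X,Y) = Σ_{x∈X} Σ_{y∈Y} w(x,y)`. -/
def cutW (w : V → V → ℝ) (X Y : Finset V) : ℝ := ∑ x ∈ X, ∑ y ∈ Y, w x y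

/-- `C(X) := C(X, V ∖ X)`. -/
def cutVal (w : V → V → ℝ) (X : Finset V) : ℝ := cutW w X Xᶜ

/-- A cut is a nonempty proper subset of `V`. -/
def IsCut (X : Finset V) : Prop := X.Nonempty ∧ X ≠ Finset.univ

/-- A mincut is a cut of minimum weight. -/
def IsMincut (w : V → V → ℝ) (X : Finset V) : Prop :=
  IsCut X ∧ ∀ Y : Finset V, IsCut Y → cutVal w X ≤ cutVal w Y

/-- `X` and `Y` cross if `X∩Y`, `X∖Y`, `Y∖X` and `V∖(X∪Y)` are all nonempty. -/
def Crosses (X Y : Finset V) : Prop :=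
  (X ∩ Y).Nonempty ∧ (X \ Y).Nonempty ∧ (Y \ X).Nonempty ∧ ((X ∪ Y)ᶜ).Nonempty

/-- A minimal mincut of a vertex `v`: a mincut containing `v` but not the root `r`,
of minimum cardinality among all such mincuts. -/
def IsMinimalMincutOfVertex (w : V → V → ℝ) (r v : V) (X : Finset V) : Prop :=
  IsMincut w X ∧ v ∈ X ∧ r ∉ X ∧
    ∀ Y : Finset V, IsMincut w Y → v ∈ Y → r ∉ Y → X.card ≤ Y.card

/-- An edge is an unordered pair of distinct vertices with positive weight. -/
def IsEdge (w : V → V → ℝ) (u₁ u₂ : V) : Prop := u₁ ≠ u₂ ∧ 0 < w u₁ u₂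

/-- A minimal mincut of an edge `{u₁,u₂}`: a mincut containing both endpoints but not the
root `r`, of minimum cardinality among all such mincuts. -/
def IsMinimalMincutOfEdge (w : V → V → ℝ) (r u₁ u₂ : V) (X : Finset V) : Prop :=
  IsEdge w u₁ u₂ ∧ IsMincut w X ∧ u₁ ∈ X ∧ u₂ ∈ X ∧ r ∉ X ∧
    ∀ Y : Finset V, IsMincut w Y → u₁ ∈ Y → u₂ ∈ Y → r ∉ Y → X.card ≤ Y.card

theorem cutVal_ind (w : V → V → ℝ) (A : Finset V) :
    cutVal w A = ∑ x, ∑ y, if x ∈ A ∧ y ∉ A then w x y else 0 := by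
  unfold cutVal cutW
  rw [← Finset.sum_filter_add_sum_filter_not univ (fun x => x ∈ A)
    (fun x => ∑ y, if x ∈ A ∧ y ∉ A then w x y else 0)]
  rw [Finset.sum_eq_zero (s := univ.filter (fun x => x ∉ A)), add_zero]
  · rw [Finset.filter_mem_eq_inter, Finset.univ_inter]
    refine Finset.sum_congr rfl fun x hx => ?_
    simp only [hx, true_and]
    rw [← Finset.sum_filter]
    congr 1
    ext y
    simp
  · intro x hx
    have : x ∉ A := by simpa using hx
    simp [this]

theorem cutVal_compl (w : V → V → ℝ) (hsym : ∀ x y, w x y = w y x) (A : Finset V) :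
    cutVal w Aᶜ = cutVal w A := by
  unfold cutVal cutW
  rw [compl_compl, Finset.sum_comm]
  simp only [hsym]

theorem cutVal_submod (w : V → V → ℝ) (hnonneg : ∀ x y, 0 ≤ w x y) (A B : Finset V) :
    cutVal w (A ∩ B) + cutVal w (A ∪ B) ≤ cutVal w A + cutVal w B := by
  simp only [cutVal_ind, ← Finset.sum_add_distrib]
  refine Finset.sum_le_sum fun x _ => Finset.sum_le_sum fun y _ => ?_
  have := hnonneg x y
  by_cases h1 : x ∈ A <;> by_cases h2 : x ∈ B <;> by_cases h3 : y ∈ A <;>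
    by_cases h4 : y ∈ B <;> simp [h1, h2, h3, h4, this]

theorem mincut_of_le (w : V → V → ℝ) {A B C D : Finset V} (hA : IsMincut w A)
    (hB : IsMincut w B) (hC : IsCut C) (hD : IsCut D)
    (h : cutVal w C + cutVal w D ≤ cutVal w A + cutVal w B) : IsMincut w C := by
  refine ⟨hC, fun Y hY => ?_⟩
  have h1 := hA.2 Y hY
  have h2 := hB.2 D hD
  linarith

theorem minimal_laminar (r : V) (w : V → V → ℝ)
    (hsym : ∀ x y, w x y = w y x) (hnonneg : ∀ x y, 0 ≤ w x y)
    {u : V} {A B : Finset V} (hA : IsMinimalMincutOfVertex w r u A)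
    (hB : IsMincut w B) (hrB : r ∉ B) (hI : (A ∩ B).Nonempty) : A ⊆ B ∨ B ⊆ A := by
  by_contra hcon
  push Not at hcon
  obtain ⟨hAB, hBA⟩ := hcon
  obtain ⟨hAm, huA, hrA, hmin⟩ := hA
  have cut : ∀ S : Finset V, S.Nonempty → r ∉ S → IsCut S := fun S hS hr =>
    ⟨hS, fun h => hr (h ▸ Finset.mem_univ r)⟩
  by_cases huB : u ∈ B
  · have hm : IsMincut w (A ∩ B) := by
      refine mincut_of_le w hAm hB (cut _ hI (by simp [hrA])) (D := A ∪ B)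
        (cut _ ⟨u, by simp [huA]⟩ (by simp [hrA, hrB])) (cutVal_submod w hnonneg A B)
    have h1 := hmin _ hm (by simp [huA, huB]) (by simp [hrA])
    have h2 : A ∩ B = A := Finset.eq_of_subset_of_card_le Finset.inter_subset_left h1
    exact hAB (Finset.inter_eq_left.mp h2)
  · have hs := cutVal_submod w hnonneg A Bᶜ
    have e1 : A ∩ Bᶜ = A \ B := by ext; simp
    have e2 : A ∪ Bᶜ = (B \ A)ᶜ := by ext; simp; tauto
    rw [e1, e2, cutVal_compl w hsym, cutVal_compl w hsym] at hs
    have hm : IsMincut w (A \ B) := by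
      refine mincut_of_le w hAm hB (cut _ ⟨u, by simp [huA, huB]⟩ (by simp [hrA]))
        (cut _ ?_ (by simp [hrB])) hs
      exact Finset.sdiff_nonempty.mpr hBA
    have h1 := hmin _ hm (by simp [huA, huB]) (by simp [hrA])
    have h2 : A \ B = A := Finset.eq_of_subset_of_card_le Finset.sdiff_subset h1
    obtain ⟨z, hz⟩ := hI
    rw [Finset.mem_inter] at hz
    rw [← h2] at hz
    exact (Finset.mem_sdiff.mp hz.1).2 hz.2

/-- if every `v ≠ r` has a minimal mincut `X v`, these are pairwise distinct,
and `X r = V`, then every `v ≠ r` has a unique "parent" `p` with `X v ⊊ X p` and no `X u`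
strictly in between. -/
theorem unique_parent
    (r : V) (w : V → V → ℝ)
    (hcard : 1 < Fintype.card V)
    (hsym : ∀ x y, w x y = w y x)
    (hnonneg : ∀ x y, 0 ≤ w x y)
    (hdiag : ∀ x, w x x = 0)
    (X : V → Finset V)
    (hXr : X r = Finset.univ)
    (hX : ∀ v : V, v ≠ r → IsMinimalMincutOfVertex w r v (X v))
    (hdist : ∀ u v : V, u ≠ r → v ≠ r → u ≠ v → X u ≠ X v)
    (v : V) (hv : v ≠ r) :
    ∃! p : V, X v ⊂ X p ∧ ∀ u : V, ¬ (X v ⊂ X u ∧ X u ⊂ X p) := by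
  have hlam : ∀ p q : V, v ∈ X p → v ∈ X q → X p ⊆ X q ∨ X q ⊆ X p := by
    intro p q hp hq
    by_cases hpr : p = r
    · right; rw [hpr, hXr]; exact Finset.subset_univ _
    by_cases hqr : q = r
    · left; rw [hqr, hXr]; exact Finset.subset_univ _
    exact minimal_laminar r w hsym hnonneg (hX p hpr) (hX q hqr).1 (hX q hqr).2.2.1
      ⟨v, Finset.mem_inter.mpr ⟨hp, hq⟩⟩
  have hinj : ∀ p q : V, X p = X q → p = q := by
    intro p q h
    by_cases hpr : p = r
    · by_contra hne
      have hqr : q ≠ r := fun h' => hne (hpr.trans h'.symm)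
      apply (hX q hqr).2.2.1
      rw [← h, hpr, hXr]; exact Finset.mem_univ r
    by_cases hqr : q = r
    · exfalso
      apply (hX p hpr).2.2.1
      rw [h, hqr, hXr]; exact Finset.mem_univ r
    by_contra hne
    exact hdist p q hpr hqr hne h
  have hvv : v ∈ X v := (hX v hv).2.1
  have hr0 : X v ⊂ X r := by
    rw [hXr, Finset.ssubset_univ_iff]
    exact (hX v hv).1.1.2
  obtain ⟨p, hp, hpm⟩ := Finset.exists_min_image (univ.filter fun p => X v ⊂ X p)
    (fun p => (X p).card) ⟨r, by simpa using hr0⟩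
  simp only [Finset.mem_filter, Finset.mem_univ, true_and] at hp hpm
  have hpp : ∀ u : V, ¬ (X v ⊂ X u ∧ X u ⊂ X p) := fun u hu =>
    absurd (hpm u hu.1) (not_le.mpr (Finset.card_lt_card hu.2))
  refine ⟨p, ⟨hp, hpp⟩, ?_⟩
  rintro q ⟨hq, hqq⟩
  apply hinj
  rcases hlam q p (hq.1 hvv) (hp.1 hvv) with h | h
  · by_contra hne
    exact hpp q ⟨hq, h.ssubset_of_ne hne⟩
  · by_contra hne
    exact hqq p ⟨hp, h.ssubset_of_ne (Ne.symm hne)⟩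
end

section
/- Let (C₀,…,C_ℓ) be a chain and let X := C₀ ∪ C₁ ∪ ⋯ ∪ C_ℓ. Then X is a mincut. -/
open Finset

variable {V : Type*} [Fintype V] [DecidableEq V]

/-- Union of the members of a chain. -/
def chainUnion (C : List (Finset V)) : Finset V := C.foldr (· ∪ ·) ∅

/-- `X ⊆ V∖{r}` has a certificate if it is the minimal mincut of some vertex,
the minimal mincut of some edge, or the union of a chain, where a chain is a sequence
`(C₀,…,C_ℓ)` (`ℓ ≥ 1`) of pairwise disjoint nonempty subsets of `V∖{r}` such that every
`C_i` has a certificate and each `C_i ∪ C_{i+1}` is the minimal mincut of some edge. -/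
inductive HasCert (w : V → V → ℝ) (r : V) : Finset V → Prop
  | vertex {v : V} {X : Finset V} : IsMinimalMincutOfVertex w r v X → HasCert w r X
  | edge {u₁ u₂ : V} {X : Finset V} : IsMinimalMincutOfEdge w r u₁ u₂ X → HasCert w r X
  | chain {C : List (Finset V)} :
      2 ≤ C.length →
      (∀ A ∈ C, A.Nonempty) →
      (∀ A ∈ C, r ∉ A) →
      C.Pairwise (fun A B => Disjoint A B) →
      (∀ A ∈ C, HasCert w r A) →
      (∀ i (h : i + 1 < C.length),
        ∃ u₁ u₂, IsMinimalMincutOfEdge w r u₁ u₂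
          (C.get ⟨i, Nat.lt_of_succ_lt h⟩ ∪ C.get ⟨i + 1, h⟩)) →
      HasCert w r (chainUnion C)

/-- `(C₀,…,C_ℓ)` with `ℓ ≥ 1` is a chain. -/
def IsMincutChain (w : V → V → ℝ) (r : V) (C : List (Finset V)) : Prop :=
  2 ≤ C.length ∧
  (∀ A ∈ C, A.Nonempty) ∧
  (∀ A ∈ C, r ∉ A) ∧
  C.Pairwise (fun A B => Disjoint A B) ∧
  (∀ A ∈ C, HasCert w r A) ∧
  (∀ i (h : i + 1 < C.length),
    ∃ u₁ u₂, IsMinimalMincutOfEdge w r u₁ u₂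
      (C.get ⟨i, Nat.lt_of_succ_lt h⟩ ∪ C.get ⟨i + 1, h⟩))

/-- A subchain is a consecutive subsequence of a chain or of its reversal. -/
def IsSubchain (D C : List (Finset V)) : Prop := D <:+: C ∨ D <:+: C.reverse

/-- A maximal chain is a chain that is not a subchain of any strictly longer chain. -/
def IsMaximalMincutChain (w : V → V → ℝ) (r : V) (C : List (Finset V)) : Prop :=
  IsMincutChain w r C ∧
    ¬ ∃ D : List (Finset V), IsMincutChain w r D ∧ C.length < D.length ∧ IsSubchain C D

/-- `lam` is the minimum weight of a cut. -/
def IsMincutValue (w : V → V → ℝ) (lam : ℝ) : Prop :=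
  (∃ X : Finset V, IsCut X ∧ cutVal w X = lam) ∧
  ∀ X : Finset V, IsCut X → lam ≤ cutVal w X

theorem cutVal_eq_sum_ite (w : V → V → ℝ) (X : Finset V) :
    cutVal w X = ∑ x, ∑ y, if x ∈ X ∧ y ∉ X then w x y else 0 := by
  unfold cutVal cutW
  rw [← Finset.sum_filter_add_sum_filter_not Finset.univ (fun x => x ∈ X)
    (fun x => ∑ y, if x ∈ X ∧ y ∉ X then w x y else 0)]
  have h2 : ∑ x ∈ Finset.univ.filter (fun x => ¬ x ∈ X),
      (∑ y, if x ∈ X ∧ y ∉ X then w x y else 0) = 0 := by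
    apply Finset.sum_eq_zero
    intro x hx
    apply Finset.sum_eq_zero
    intro y _
    have : x ∉ X := by simpa using hx
    simp [this]
  rw [h2, add_zero]
  have h3 : Finset.univ.filter (fun x => x ∈ X) = X := by ext; simp
  rw [h3]
  apply Finset.sum_congr rfl
  intro x hx
  have h4 : Xᶜ = Finset.univ.filter (fun y => y ∉ X) := by ext; simp
  rw [h4, Finset.sum_filter]
  simp [hx]

theorem cutVal_submodular (w : V → V → ℝ) (hnonneg : ∀ x y, 0 ≤ w x y) (X Y : Finset V) :
    cutVal w (X ∩ Y) + cutVal w (X ∪ Y) ≤ cutVal w X + cutVal w Y := by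
  simp only [cutVal_eq_sum_ite, ← Finset.sum_add_distrib]
  refine Finset.sum_le_sum fun x _ => Finset.sum_le_sum fun y _ => ?_
  have := hnonneg x y
  by_cases h1 : x ∈ X <;> by_cases h2 : x ∈ Y <;> by_cases h3 : y ∈ X <;>
    by_cases h4 : y ∈ Y <;> simp [h1, h2, h3, h4, this]

theorem IsMincut.union_of_inter (w : V → V → ℝ) (hnonneg : ∀ x y, 0 ≤ w x y) (r : V)
    {X Y : Finset V} (hX : IsMincut w X) (hY : IsMincut w Y)
    (hne : (X ∩ Y).Nonempty) (hr : r ∉ X ∪ Y) : IsMincut w (X ∪ Y) := by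
  have hcI : IsCut (X ∩ Y) := by
    refine ⟨hne, fun h => hr ?_⟩
    have : r ∈ X ∩ Y := by rw [h]; exact Finset.mem_univ r
    exact Finset.mem_union_left _ (Finset.mem_inter.1 this).1
  have hcU : IsCut (X ∪ Y) := by
    refine ⟨hX.1.1.mono Finset.subset_union_left, fun h => hr ?_⟩
    rw [h]; exact Finset.mem_univ r
  refine ⟨hcU, fun Z hZ => ?_⟩
  have h1 := cutVal_submodular w hnonneg X Y
  have h2 := hX.2 Z hZ
  have h3 := hY.2 _ hcI
  linarith

theorem chainUnion_isMincut_aux (w : V → V → ℝ) (hnonneg : ∀ x y, 0 ≤ w x y) (r : V)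
    (L : List (Finset V)) : ∀ A B : Finset V,
    (∀ D ∈ A :: B :: L, D.Nonempty) → (∀ D ∈ A :: B :: L, r ∉ D) →
    (∀ i (h : i + 1 < (A :: B :: L).length), IsMincut w
      ((A :: B :: L).get ⟨i, Nat.lt_of_succ_lt h⟩ ∪ (A :: B :: L).get ⟨i + 1, h⟩)) →
    IsMincut w (chainUnion (A :: B :: L)) ∧ r ∉ chainUnion (A :: B :: L) := by
  induction L with
  | nil =>
    intro A B _ hr hm
    have h := hm 0 (by simp)
    have h1 := hr A (by simp)
    have h2 := hr B (by simp)
    constructor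
    · simpa [chainUnion] using h
    · simp [chainUnion, h1, h2]
  | cons D L ih =>
    intro A B hne hr hm
    have hrest := ih B D (fun E hE => hne E (List.mem_cons_of_mem _ hE))
      (fun E hE => hr E (List.mem_cons_of_mem _ hE))
      (fun i h => hm (i + 1) (by simpa using h))
    have hAB : IsMincut w (A ∪ B) := hm 0 (by simp)
    have hrA := hr A (by simp)
    have hrB := hr B (by simp)
    have hBsub : B ⊆ chainUnion (B :: D :: L) := Finset.subset_union_left
    have heq : chainUnion (A :: B :: D :: L) = (A ∪ B) ∪ chainUnion (B :: D :: L) := by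
      change A ∪ chainUnion (B :: D :: L) = _
      rw [Finset.union_assoc, Finset.union_eq_right.2 hBsub]
    have hrU : r ∉ (A ∪ B) ∪ chainUnion (B :: D :: L) := by
      simp only [Finset.mem_union, not_or]
      exact ⟨⟨hrA, hrB⟩, hrest.2⟩
    rw [heq]
    refine ⟨IsMincut.union_of_inter w hnonneg r hAB hrest.1 ?_ hrU, hrU⟩
    exact (hne B (by simp)).mono (Finset.subset_inter Finset.subset_union_right hBsub)

/-- the union of a chain is a mincut. -/
theorem chainUnion_isMincut
    (r : V) (w : V → V → ℝ)
    (hcard : 1 < Fintype.card V)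
    (hsym : ∀ x y, w x y = w y x)
    (hnonneg : ∀ x y, 0 ≤ w x y)
    (hdiag : ∀ x, w x x = 0)
    (C : List (Finset V)) (hC : IsMincutChain w r C) :
    IsMincut w (chainUnion C) := by
  obtain ⟨hlen, hne, hr, _, _, hm⟩ := hC
  match C, hlen, hne, hr, hm with
  | A :: B :: L, _, hne, hr, hm =>
    refine (chainUnion_isMincut_aux w hnonneg r L A B hne hr fun i h => ?_).1
    obtain ⟨_, _, h'⟩ := hm i h
    exact h'.2.1
end

section
/- Let (C₀,…,C_ℓ) be a chain and let X := C₀ ∪ ⋯ ∪ C_ℓ. Then for every 0 ≤ i < ℓ, C(C_i, C_{i+1}) = λ/2; moreover C(C₀, V∖X) = C(C_ℓ, V∖X) = λ/2; and for all indices i, j with |i − j| > 1, C(C_i, C_j) = 0. -/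
open Finset

variable {V : Type*} [Fintype V] [DecidableEq V]

lemma cw_union_right (w : V → V → ℝ) (A B D : Finset V) (h : Disjoint B D) :
    cutW w A (B ∪ D) = cutW w A B + cutW w A D := by
  simp only [cutW, Finset.sum_union h, Finset.sum_add_distrib]

lemma cw_union_left (w : V → V → ℝ) (A B D : Finset V) (h : Disjoint A B) :
    cutW w (A ∪ B) D = cutW w A D + cutW w B D := by
  simp only [cutW, Finset.sum_union h]

lemma cw_comm (w : V → V → ℝ) (hsym : ∀ x y, w x y = w y x) (A B : Finset V) :
    cutW w A B = cutW w B A := by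
  unfold cutW
  rw [Finset.sum_comm]
  simp only [hsym]

lemma cw_nonneg (w : V → V → ℝ) (hn : ∀ x y, 0 ≤ w x y) (A B : Finset V) :
    0 ≤ cutW w A B :=
  Finset.sum_nonneg fun _ _ => Finset.sum_nonneg fun _ _ => hn _ _

lemma cw_mono (w : V → V → ℝ) (hn : ∀ x y, 0 ≤ w x y) (A B D : Finset V) (h : B ⊆ D) :
    cutW w A B ≤ cutW w A D :=
  Finset.sum_le_sum fun _ _ => Finset.sum_le_sum_of_subset_of_nonneg h fun _ _ _ => hn _ _

lemma cw_compl (w : V → V → ℝ) (A B : Finset V) :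
    cutW w A Bᶜ = cutW w A Finset.univ - cutW w A B := by
  rw [← Finset.union_compl B, cw_union_right w A B Bᶜ disjoint_compl_right]
  ring

lemma cv_union (w : V → V → ℝ) (hsym : ∀ x y, w x y = w y x) (A B : Finset V)
    (h : Disjoint A B) :
    cutVal w (A ∪ B) = cutVal w A + cutVal w B - 2 * cutW w A B := by
  simp only [cutVal, cw_compl, cw_union_left w A B _ h, cw_union_right w _ A B h,
    cw_comm w hsym B A]
  ring

lemma mem_chainUnion (C : List (Finset V)) (x : V) : x ∈ chainUnion C ↔ ∃ A ∈ C, x ∈ A := by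
  induction C with
  | nil => simp [chainUnion]
  | cons A L ih =>
    have : chainUnion (A :: L) = A ∪ chainUnion L := rfl
    simp [this, ih]

lemma chainUnion_cons (A : Finset V) (L : List (Finset V)) :
    chainUnion (A :: L) = A ∪ chainUnion L := rfl

/-- Numerical data of a chain. -/
structure GoodChain (w : V → V → ℝ) (r : V) (lam : ℝ) (C : List (Finset V)) : Prop where
  ne : ∀ A ∈ C, A.Nonempty
  root : ∀ A ∈ C, r ∉ A
  disj : C.Pairwise (fun A B => Disjoint A B)
  val : ∀ A ∈ C, cutVal w A = lam
  adj : ∀ i (h : i + 1 < C.length), cutVal w (C[i] ∪ C[i+1]) = lam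

lemma GoodChain.tail {w : V → V → ℝ} {r : V} {lam : ℝ} {A : Finset V} {L : List (Finset V)}
    (h : GoodChain w r lam (A :: L)) : GoodChain w r lam L where
  ne B hB := h.ne B (List.mem_cons_of_mem _ hB)
  root B hB := h.root B (List.mem_cons_of_mem _ hB)
  disj := (List.pairwise_cons.1 h.disj).2
  val B hB := h.val B (List.mem_cons_of_mem _ hB)
  adj i hi := h.adj (i+1) (by simpa using hi)

lemma GoodChain.disj_union {w : V → V → ℝ} {r : V} {lam : ℝ} {A : Finset V}
    {L : List (Finset V)} (h : GoodChain w r lam (A :: L)) : Disjoint A (chainUnion L) := by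
  rw [Finset.disjoint_left]
  intro x hx hxL
  obtain ⟨B, hB, hxB⟩ := (mem_chainUnion L x).1 hxL
  exact Finset.disjoint_left.1 ((List.pairwise_cons.1 h.disj).1 B hB) hx hxB

lemma GoodChain.first {w : V → V → ℝ} (hsym : ∀ x y, w x y = w y x) {r : V} {lam : ℝ}
    {A B : Finset V} {L : List (Finset V)} (h : GoodChain w r lam (A :: B :: L)) :
    cutW w A B = lam / 2 := by
  have h1 := h.adj 0 (by simp)
  simp only [List.getElem_cons_zero, List.getElem_cons_succ, Nat.zero_add] at h1
  rw [cv_union w hsym A B ((List.pairwise_cons.1 h.disj).1 B (by simp)),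
    h.val A (by simp), h.val B (by simp)] at h1
  linarith

lemma GoodChain.isCut {w : V → V → ℝ} {r : V} {lam : ℝ} {A : Finset V}
    {L : List (Finset V)} (h : GoodChain w r lam (A :: L)) : IsCut (chainUnion (A :: L)) := by
  constructor
  · obtain ⟨x, hx⟩ := h.ne A (by simp)
    exact ⟨x, (mem_chainUnion _ _).2 ⟨A, by simp, hx⟩⟩
  · intro hu
    obtain ⟨B, hB, hr⟩ := (mem_chainUnion (A :: L) r).1 (hu ▸ Finset.mem_univ r)
    exact h.root B hB hr

lemma GoodChain.main {w : V → V → ℝ} (hsym : ∀ x y, w x y = w y x)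
    (hn : ∀ x y, 0 ≤ w x y) {r : V} {lam : ℝ}
    (hmin : ∀ X : Finset V, IsCut X → lam ≤ cutVal w X) (L : List (Finset V)) :
    ∀ A, GoodChain w r lam (A :: L) → cutVal w (chainUnion (A :: L)) = lam ∧
      (L ≠ [] → cutW w A (chainUnion L) = lam / 2) := by
  induction L with
  | nil => intro A h; simpa [chainUnion] using h.val A (by simp)
  | cons B L ih =>
    intro A h
    have h1 := (ih B h.tail).1
    have h2 := hmin _ h.isCut
    have h3 := cv_union w hsym A _ h.disj_union
    have h4 := h.first hsym
    have h5 := cw_mono w hn A B (chainUnion (B :: L)) (by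
      rw [chainUnion_cons]; exact Finset.subset_union_left)
    rw [chainUnion_cons A] at h2 ⊢
    have h6 := h.val A (by simp)
    refine ⟨by linarith, fun _ => by linarith⟩

lemma GoodChain.far_zero {w : V → V → ℝ} (hsym : ∀ x y, w x y = w y x)
    (hn : ∀ x y, 0 ≤ w x y) {r : V} {lam : ℝ}
    (hmin : ∀ X : Finset V, IsCut X → lam ≤ cutVal w X) {A B D : Finset V}
    {L : List (Finset V)} (h : GoodChain w r lam (A :: B :: L)) (hD : D ∈ L) :
    cutW w A D = 0 := by
  have h1 := (h.main hsym hn hmin).2 (by simp)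
  rw [chainUnion_cons, cw_union_right w _ _ _ h.tail.disj_union, h.first hsym] at h1
  have h2 := cw_mono w hn A D (chainUnion L) (fun x hx => (mem_chainUnion _ _).2 ⟨D, hD, hx⟩)
  have h3 := cw_nonneg w hn A D
  linarith

lemma GoodChain.nonadj {w : V → V → ℝ} (hsym : ∀ x y, w x y = w y x)
    (hn : ∀ x y, 0 ≤ w x y) {r : V} {lam : ℝ}
    (hmin : ∀ X : Finset V, IsCut X → lam ≤ cutVal w X) (C : List (Finset V)) :
    GoodChain w r lam C → ∀ i j (hi : i < C.length) (hj : j < C.length), i + 1 < j →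
      cutW w C[i] C[j] = 0 := by
  induction C with
  | nil => intro _ i j hi; simp at hi
  | cons A L ih =>
    intro h i j hi hj hij
    obtain ⟨j, rfl⟩ : ∃ k, j = k + 2 := ⟨j - 2, by omega⟩
    cases i with
    | succ i =>
      exact ih h.tail i (j+1) (by simpa using hi) (Nat.lt_of_succ_lt_succ hj) (by omega)
    | zero =>
      cases L with
      | nil => simp at hj
      | cons B L => exact h.far_zero hsym hn hmin (by simp)

lemma GoodChain.step {w : V → V → ℝ} (hsym : ∀ x y, w x y = w y x) {r : V} {lam : ℝ}
    (C : List (Finset V)) (h : GoodChain w r lam C) (i : ℕ) (hi : i + 1 < C.length) :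
    cutW w C[i] C[i+1] = lam / 2 := by
  have h1 := h.adj i hi
  rw [cv_union w hsym _ _ (List.pairwise_iff_getElem.1 h.disj i (i+1) (by omega) hi (by omega)),
    h.val _ (List.getElem_mem _), h.val _ (List.getElem_mem _)] at h1
  linarith

lemma GoodChain.head {w : V → V → ℝ} (hsym : ∀ x y, w x y = w y x)
    (hn : ∀ x y, 0 ≤ w x y) {r : V} {lam : ℝ}
    (hmin : ∀ X : Finset V, IsCut X → lam ≤ cutVal w X) {A B : Finset V}
    {L : List (Finset V)} (h : GoodChain w r lam (A :: B :: L)) :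
    cutW w A (chainUnion (A :: B :: L))ᶜ = lam / 2 := by
  have h1 := (h.main hsym hn hmin).2 (by simp)
  have h2 := h.val A (by simp)
  rw [cutVal, cw_compl] at h2
  rw [chainUnion_cons, cw_compl, cw_union_right w _ _ _ h.disj_union]
  linarith

lemma GoodChain.last {w : V → V → ℝ} (hsym : ∀ x y, w x y = w y x)
    (hn : ∀ x y, 0 ≤ w x y) {r : V} {lam : ℝ}
    (hmin : ∀ X : Finset V, IsCut X → lam ≤ cutVal w X) (L : List (Finset V)) :
    ∀ A B, GoodChain w r lam (A :: B :: L) →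
    cutW w ((A :: B :: L).getLast (by simp)) (chainUnion (A :: B :: L))ᶜ = lam / 2 := by
  induction L with
  | nil =>
    intro A B h
    have h1 := h.first hsym
    have h2 := h.val B (by simp)
    have h3 := h.disj_union
    rw [cutVal, cw_compl] at h2
    have e : chainUnion [B] = B := by simp [chainUnion]
    rw [e] at h3
    rw [chainUnion_cons, e, cw_compl, cw_union_right w _ _ _ h3]
    simp only [List.getLast_cons_cons, List.getLast_singleton]
    rw [cw_comm w hsym B A]
    linarith
  | cons D L ih =>
    intro A B h
    have h1 := ih B D h.tail
    have h2 : cutW w A ((D :: L).getLast (by simp)) = 0 :=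
      h.far_zero hsym hn hmin (List.getLast_mem _)
    rw [chainUnion_cons, cw_compl, cw_union_right w _ _ _ h.disj_union]
    rw [cw_compl] at h1
    simp only [List.getLast_cons_cons] at h1 ⊢
    rw [cw_comm w hsym _ A, h2]
    linarith

lemma IsMincut.val_eq {w : V → V → ℝ} {lam : ℝ} (hlam : IsMincutValue w lam) {X : Finset V}
    (h : IsMincut w X) : cutVal w X = lam := by
  obtain ⟨⟨Y, hY, rfl⟩, h2⟩ := hlam
  exact le_antisymm (h.2 Y hY) (h2 X h.1)

lemma HasCert.val_eq {w : V → V → ℝ} (hsym : ∀ x y, w x y = w y x)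
    (hn : ∀ x y, 0 ≤ w x y) {r : V} {lam : ℝ} (hlam : IsMincutValue w lam) {X : Finset V}
    (h : HasCert w r X) : cutVal w X = lam := by
  induction h with
  | vertex h => exact h.1.val_eq hlam
  | edge h => exact h.2.1.val_eq hlam
  | @chain C h2 hne hr hd _ hadj ih =>
    have g : GoodChain w r lam C := ⟨hne, hr, hd, ih, fun i hi => by
      obtain ⟨_, _, h⟩ := hadj i hi
      exact h.2.1.val_eq hlam⟩
    cases C with
    | nil => simp at h2
    | cons A L => exact (g.main hsym hn hlam.2).1

/-- in a chain `(C₀,…,C_ℓ)` with union `X`, `C(C_i, C_{i+1}) = λ/2` for all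
`0 ≤ i < ℓ`, `C(C₀, V∖X) = C(C_ℓ, V∖X) = λ/2`, and `C(C_i, C_j) = 0` when `|i−j| > 1`. -/
theorem chain_neighbor_degrees
    (r : V) (w : V → V → ℝ)
    (hcard : 1 < Fintype.card V)
    (hsym : ∀ x y, w x y = w y x)
    (hnonneg : ∀ x y, 0 ≤ w x y)
    (hdiag : ∀ x, w x x = 0)
    (lam : ℝ) (hlam : IsMincutValue w lam)
    (C : List (Finset V)) (hC : IsMincutChain w r C) (hne : C ≠ []) :
    (∀ i (h : i + 1 < C.length),
      cutW w (C.get ⟨i, Nat.lt_of_succ_lt h⟩) (C.get ⟨i + 1, h⟩) = lam / 2) ∧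
    cutW w (C.head hne) (chainUnion C)ᶜ = lam / 2 ∧
    cutW w (C.getLast hne) (chainUnion C)ᶜ = lam / 2 ∧
    (∀ i j (hi : i < C.length) (hj : j < C.length), (i + 1 < j ∨ j + 1 < i) →
      cutW w (C.get ⟨i, hi⟩) (C.get ⟨j, hj⟩) = 0) := by
  obtain ⟨h2, hN, hr, hd, hc, hadj⟩ := hC
  have g : GoodChain w r lam C := ⟨hN, hr, hd, fun A hA => (hc A hA).val_eq hsym hnonneg hlam,
    fun i hi => by
      obtain ⟨_, _, h⟩ := hadj i hi
      exact h.2.1.val_eq hlam⟩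
  refine ⟨fun i h => g.step hsym C i h, ?_, ?_, ?_⟩
  · match C, h2, g with
    | A :: B :: L, _, g => exact g.head hsym hnonneg hlam.2
  · match C, h2, g with
    | A :: B :: L, _, g => exact g.last hsym hnonneg hlam.2
  · rintro i j hi hj (h | h)
    · exact g.nonadj hsym hnonneg hlam.2 C i j hi hj h
    · rw [cw_comm w hsym]
      exact g.nonadj hsym hnonneg hlam.2 C j i hj hi h
end
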